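/- Quantum discord is non-negative: for any bipartite density operator ρ_AB on finite-dimensional H_A ⊗ H_B, D(A:B) = H(ρ_B) − H(ρ_AB) + min_{{Π_i}} Σ_i p_i H(ρ_{A|i}) ≥ 0, where the minimum is over rank-1 POVMs {Π_i} on B, p_i = Tr((I_A ⊗ Π_i)ρ_AB), and ρ_{A|i} = Tr_B((I_A ⊗ Π_i)ρ_AB)/p_i. -/

import Mathlib

open Matrix Kronecker BigOperators ComplexOrder

noncomputable section

/-- von Neumann entropy of a (Hermitian) matrix; 0 if not Hermitian. -/
def vNEntropy {n : Type} [Fintype n] [DecidableEq n] (ρ : Matrix n n ℂ) : ℝ :=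
  if h : ρ.IsHermitian then ∑ i, Real.negMulLog (h.eigenvalues i) else 0

/-- Shannon entropy of a finitely supported probability vector. -/
def shannonEntropy {ι : Type} [Fintype ι] (p : ι → ℝ) : ℝ := ∑ i, Real.negMulLog (p i)

/-- Density operator predicate. -/
def IsDensity {n : Type} [Fintype n] [DecidableEq n] (ρ : Matrix n n ℂ) : Prop :=
  ρ.PosSemidef ∧ ρ.trace = 1

/-- |v⟩⟨w| -/
def ketbra {n : Type} (v w : n → ℂ) : Matrix n n ℂ := fun i j => v i * star (w j)

/-- Orthonormal family. -/
def OrthoFam {ι n : Type} [Fintype n] [DecidableEq ι] (v : ι → n → ℂ) : Prop :=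
  ∀ j k, (∑ i, star (v j i) * v k i) = if j = k then 1 else 0

/-- Partial trace over the first (A) factor. -/
def ptrA {dA dB : Type} [Fintype dA] (ρ : Matrix (dA × dB) (dA × dB) ℂ) : Matrix dB dB ℂ :=
  fun b b' => ∑ a, ρ (a, b) (a, b')

/-- Partial trace over the second (B) factor. -/
def ptrB {dA dB : Type} [Fintype dB] (ρ : Matrix (dA × dB) (dA × dB) ℂ) : Matrix dA dA ℂ :=
  fun a a' => ∑ b, ρ (a, b) (a', b)

/-- Outcome probability for POVM element E on B. -/
def pOf {dA dB : Type} [Fintype dA] [Fintype dB] [DecidableEq dA]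
    (ρ : Matrix (dA × dB) (dA × dB) ℂ) (E : Matrix dB dB ℂ) : ℝ :=
  (((1 : Matrix dA dA ℂ) ⊗ₖ E * ρ).trace).re

/-- Conditional state of A given POVM element E on B. -/
def condState {dA dB : Type} [Fintype dA] [Fintype dB] [DecidableEq dA] [DecidableEq dB]
    (ρ : Matrix (dA × dB) (dA × dB) ℂ) (E : Matrix dB dB ℂ) : Matrix dA dA ℂ :=
  ((pOf ρ E : ℂ))⁻¹ • ptrB ((1 : Matrix dA dA ℂ) ⊗ₖ E * ρ)

/-- Set of measured conditional entropies over rank-1 POVMs on B. -/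
def measuredCondEntropies {dA dB : Type} [Fintype dA] [Fintype dB] [DecidableEq dA] [DecidableEq dB]
    (ρ : Matrix (dA × dB) (dA × dB) ℂ) : Set ℝ :=
  { x | ∃ (m : ℕ) (M : Fin m → Matrix dB dB ℂ),
      (∀ i, (M i).PosSemidef) ∧ (∀ i, (M i).rank ≤ 1) ∧ (∑ i, M i = 1) ∧
      x = ∑ i, pOf ρ (M i) * vNEntropy (condState ρ (M i)) }

/-- Quantum discord with measurements on B. -/
def discord {dA dB : Type} [Fintype dA] [Fintype dB] [DecidableEq dA] [DecidableEq dB]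
    (ρ : Matrix (dA × dB) (dA × dB) ℂ) : ℝ :=
  vNEntropy (ptrA ρ) - vNEntropy ρ + sInf (measuredCondEntropies ρ)

/-- The B-contraction ⟨e_j| ρ |e_k⟩ as operator on A. -/
def bContract {dA dB : Type} [Fintype dB]
    (ρ : Matrix (dA × dB) (dA × dB) ℂ) (u v : dB → ℂ) : Matrix dA dA ℂ :=
  fun a a' => ∑ b, ∑ b', star (u b) * ρ (a, b) (a', b') * v b'

/-- Extended state ρ'_ABC from measuring B in basis e, recorded in C with family f. -/
def extState {dA dB dC : Type} [Fintype dA] [Fintype dB] [Fintype dC]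
    (ρ : Matrix (dA × dB) (dA × dB) ℂ) (e : dB → dB → ℂ) (f : dB → dC → ℂ) :
    Matrix (dA × dB × dC) (dA × dB × dC) ℂ :=
  fun x y => ∑ j, ∑ k,
    bContract ρ (e j) (e k) x.1 y.1 * e j x.2.1 * star (e k y.2.1) * f j x.2.2 * star (f k y.2.2)

/-- Partial trace over C for a tripartite A ⊗ B ⊗ C matrix. -/
def ptrC3 {dA dB dC : Type} [Fintype dC]
    (ρ : Matrix (dA × dB × dC) (dA × dB × dC) ℂ) : Matrix (dA × dB) (dA × dB) ℂ :=
  fun x y => ∑ c, ρ (x.1, x.2, c) (y.1, y.2, c)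

/-- Partial trace over A for a tripartite matrix. -/
def ptrA3 {dA dB dC : Type} [Fintype dA]
    (ρ : Matrix (dA × dB × dC) (dA × dB × dC) ℂ) : Matrix (dB × dC) (dB × dC) ℂ :=
  fun x y => ∑ a, ρ (a, x.1, x.2) (a, y.1, y.2)

/-- Partial trace over both A and C. -/
def ptrAC3 {dA dB dC : Type} [Fintype dA] [Fintype dC]
    (ρ : Matrix (dA × dB × dC) (dA × dB × dC) ℂ) : Matrix dB dB ℂ :=
  fun b b' => ∑ a, ∑ c, ρ (a, b, c) (a, b', c)


/-- If the resolvent sums of one weighted family dominate those of another of the same total weight,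
then the logarithmic sums are ordered the other way. -/
theorem sum_mul_log_le_of_resolvent_le {α β : Type*} [Fintype α] [Fintype β]
    {c l : α → ℝ} {d m : β → ℝ} (hl : ∀ a, 0 ≤ l a) (hm : ∀ b, 0 ≤ m b)
    (hcl : ∀ a, c a ≠ 0 → l a ≠ 0) (hdm : ∀ b, d b ≠ 0 → m b ≠ 0)
    (hsum : ∑ a, c a = ∑ b, d b)
    (hres : ∀ s : ℝ, 0 < s → ∑ b, d b / (m b + s) ≤ ∑ a, c a / (l a + s)) :
    ∑ a, c a * Real.log (l a) ≤ ∑ b, d b * Real.log (m b) := by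
  set G : ℝ → ℝ := fun s =>
    ∑ a, c a * Real.log (l a + s) - ∑ b, d b * Real.log (m b + s) with hG
  have hterm : ∀ (w x : ℝ), 0 ≤ x → (w ≠ 0 → x ≠ 0) →
      ContinuousOn (fun s => w * Real.log (x + s)) (Set.Ici 0) := by
    intro w x hx hwx
    by_cases hw : w = 0
    · simpa [hw] using continuousOn_const
    · refine continuousOn_const.mul (ContinuousOn.log (by fun_prop) fun s hs => ?_)
      have := lt_of_le_of_ne hx (hwx hw).symm
      have : 0 ≤ s := hs
      positivity
  have hcont : ContinuousOn G (Set.Ici 0) :=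
    (continuousOn_finsetSum _ fun a _ => hterm _ _ (hl a) (hcl a)).sub
      (continuousOn_finsetSum _ fun b _ => hterm _ _ (hm b) (hdm b))
  have hderiv : ∀ s : ℝ, 0 < s →
      HasDerivAt G (∑ a, c a / (l a + s) - ∑ b, d b / (m b + s)) s := by
    intro s hs
    have key : ∀ (w x : ℝ), 0 ≤ x →
        HasDerivAt (fun s => w * Real.log (x + s)) (w / (x + s)) s := by
      intro w x hx
      have h1 : HasDerivAt (fun s => x + s) 1 s := (hasDerivAt_id s).const_add x
      have h2 := (h1.log (by positivity)).const_mul w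
      simpa [div_eq_mul_inv] using h2
    exact (HasDerivAt.fun_sum fun a _ => key _ _ (hl a)).sub
      (HasDerivAt.fun_sum fun b _ => key _ _ (hm b))
  have hmono : MonotoneOn G (Set.Ici 0) := by
    refine monotoneOn_of_deriv_nonneg (convex_Ici 0) hcont ?_ ?_
    · intro s hs
      rw [interior_Ici] at hs
      exact (hderiv s hs).differentiableAt.differentiableWithinAt
    · intro s hs
      rw [interior_Ici] at hs
      rw [(hderiv s hs).deriv]
      exact sub_nonneg.2 (hres s hs)
  have hlim : Filter.Tendsto G Filter.atTop (nhds 0) := by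
    have key : ∀ w x : ℝ, Filter.Tendsto (fun s => w * (Real.log (s + x) - Real.log s))
        Filter.atTop (nhds 0) := fun w x => by
      simpa using (Real.tendsto_log_comp_add_sub_log x).const_mul w
    have h := (tendsto_finsetSum Finset.univ fun a _ => key (c a) (l a)).sub
      (tendsto_finsetSum Finset.univ fun b _ => key (d b) (m b))
    simp only [Finset.sum_const_zero, sub_zero] at h
    refine h.congr fun s => ?_
    simp only [hG, mul_sub, Finset.sum_sub_distrib, ← Finset.sum_mul, hsum, add_comm s]
    ring
  have h0 : G 0 ≤ 0 := by
    refine ge_of_tendsto hlim ?_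
    filter_upwards [Filter.eventually_ge_atTop 0] with s hs
    exact hmono Set.self_mem_Ici hs hs
  simpa [hG] using h0

open scoped MatrixOrder in
theorem Matrix.PosSemidef.trace_mul_nonneg {n : Type*} [Fintype n] [DecidableEq n]
    {A B : Matrix n n ℂ} (hA : A.PosSemidef) (hB : B.PosSemidef) : 0 ≤ (A * B).trace := by
  obtain ⟨C, rfl⟩ := CStarAlgebra.nonneg_iff_eq_star_mul_self.mp hA.nonneg
  rw [star_eq_conjTranspose, Matrix.mul_assoc, trace_mul_comm]
  exact (hB.mul_mul_conjTranspose_same C).trace_nonneg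

/-- Real part of the trace of `D X Yᴴ` for a real diagonal matrix `D`. -/
theorem re_trace_diagonal_mul {n : Type*} [Fintype n] [DecidableEq n] (r : n → ℝ)
    (X Y : Matrix n n ℂ) :
    ((diagonal (fun i => (r i : ℂ)) * (X * Yᴴ)).trace).re
      = ∑ i, ∑ j, r i * (X i j * star (Y i j)).re := by
  simp only [Matrix.trace, diag_apply, diagonal_mul, Complex.re_sum, Complex.re_ofReal_mul,
    Matrix.mul_apply (M := X), Finset.mul_sum, conjTranspose_apply]

theorem two_mul_sub_le_sq_div (r d : ℝ) (hd : 0 ≤ d) (hrd : d = 0 → r = 0) (k w : ℂ) :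
    2 * (r * (k * star w).re) - d * Complex.normSq k ≤ r ^ 2 * Complex.normSq w / d := by
  rcases hd.eq_or_lt with h | h
  · simp [← h, hrd h.symm]
  · rw [le_div_iff₀ h]
    simp only [Complex.normSq_apply, RCLike.star_def, Complex.mul_re, Complex.conj_re,
      Complex.conj_im]
    nlinarith [sq_nonneg (d * k.re - r * w.re), sq_nonneg (d * k.im - r * w.im)]

/-- Resolvent form of the monotonicity of relative entropy under a measurement. -/
theorem measured_resolvent_le {n ι : Type*} [Fintype n] [DecidableEq n] [Fintype ι]
    (U V : unitaryGroup n ℂ) {r t : n → ℝ} (hr : ∀ i, 0 ≤ r i) (ht : ∀ i, 0 ≤ t i)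
    {ρ τ : Matrix n n ℂ}
    (hρ : ρ = (U : Matrix n n ℂ) * diagonal (fun i => (r i : ℂ)) * (U : Matrix n n ℂ)ᴴ)
    (hτ : τ = (V : Matrix n n ℂ) * diagonal (fun i => (t i : ℂ)) * (V : Matrix n n ℂ)ᴴ)
    {E : ι → Matrix n n ℂ} (hE : ∀ x, (E x).PosSemidef) (hE1 : ∑ x, E x = 1)
    {P Q : ι → ℝ} (hP : ∀ x, P x = ((E x * ρ).trace).re) (hQ : ∀ x, Q x = ((E x * τ).trace).re)
    {s : ℝ} (hs : 0 < s) :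
    ∑ x, P x ^ 2 / (Q x + s * P x) ≤ ∑ i, ∑ j, r i ^ 2 *
      Complex.normSq (((U : Matrix n n ℂ)ᴴ * (V : Matrix n n ℂ)) i j) / (t j + s * r i) := by
  obtain ⟨U, hU⟩ := U
  obtain ⟨V, hV⟩ := V
  simp only at hρ hτ ⊢
  have hU1 : U * Uᴴ = 1 := mem_unitaryGroup_iff.1 hU
  have hV1 : V * Vᴴ = 1 := mem_unitaryGroup_iff.1 hV
  have hpsd : ∀ {W : Matrix n n ℂ} {q : n → ℝ}, (∀ i, 0 ≤ q i) →
      (W * diagonal (fun i => (q i : ℂ)) * Wᴴ).PosSemidef := fun {W q} hq =>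
    (PosSemidef.diagonal fun i => by simpa using hq i).mul_mul_conjTranspose_same W
  have hρp : ρ.PosSemidef := hρ ▸ hpsd hr
  have hτp : τ.PosSemidef := hτ ▸ hpsd ht
  have hP0 : ∀ x, 0 ≤ P x := fun x => by
    rw [hP]; exact (Complex.nonneg_iff.1 ((hE x).trace_mul_nonneg hρp)).1
  have hQ0 : ∀ x, 0 ≤ Q x := fun x => by
    rw [hQ]; exact (Complex.nonneg_iff.1 ((hE x).trace_mul_nonneg hτp)).1
  set k : ι → ℝ := fun x => P x / (Q x + s * P x) with hk
  set K : Matrix n n ℂ := ∑ x, (k x : ℂ) • E x with hK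
  have hKh : Kᴴ = K := by
    simp only [hK, conjTranspose_sum, conjTranspose_smul, (hE _).1.eq]
    simp
  have hterm : ∀ x, P x ^ 2 / (Q x + s * P x)
      = 2 * (k x * P x) - k x ^ 2 * (Q x + s * P x) := by
    intro x
    have hQx := hQ0 x
    have hPx := hP0 x
    rcases hPx.eq_or_lt with h | h
    · simp [hk, ← h]
    · have : Q x + s * P x ≠ 0 := by positivity
      simp only [hk]
      field_simp
      ring
  have hjensen : ∀ A : Matrix n n ℂ, A.PosSemidef →
      ((K * K * A).trace).re ≤ ∑ x, k x ^ 2 * ((E x * A).trace).re := by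
    intro A hA
    have hsq : ∑ x, ((k x : ℂ) • (1 : Matrix n n ℂ) - K) * E x * ((k x : ℂ) • 1 - K)ᴴ
        = ∑ x, ((k x : ℂ) ^ 2) • E x - K * K := by
      have : ∀ x, ((k x : ℂ) • (1 : Matrix n n ℂ) - K) * E x * ((k x : ℂ) • 1 - K)ᴴ
          = ((k x : ℂ) ^ 2) • E x - K * ((k x : ℂ) • E x) - ((k x : ℂ) • E x) * K
            + K * E x * K := by
        intro x
        simp only [conjTranspose_sub, conjTranspose_smul, conjTranspose_one, hKh, sub_mul, mul_sub,
          smul_mul_assoc, mul_smul_comm, one_mul, mul_one, smul_sub, smul_smul, RCLike.star_def,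
          Complex.conj_ofReal, sq]
        abel
      simp only [this, Finset.sum_add_distrib, Finset.sum_sub_distrib, ← Finset.mul_sum,
        ← Finset.sum_mul, hE1, mul_one, ← hK]
      abel
    have h0 : 0 ≤ ((∑ x, ((k x : ℂ) ^ 2) • E x - K * K) * A).trace := by
      rw [← hsq]
      exact (posSemidef_sum _ fun x _ => (hE x).mul_mul_conjTranspose_same _).trace_mul_nonneg hA
    have h1 := (Complex.nonneg_iff.1 h0).1
    rw [sub_mul, trace_sub, Complex.sub_re, Finset.sum_mul, trace_sum, Complex.re_sum] at h1
    have h2 : ∀ x, (((k x : ℂ) ^ 2 • E x * A).trace).re = k x ^ 2 * ((E x * A).trace).re := by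
      intro x
      rw [smul_mul_assoc, trace_smul, smul_eq_mul, ← Complex.ofReal_pow, Complex.re_ofReal_mul]
    simp only [h2] at h1
    linarith
  set L : Matrix n n ℂ := Uᴴ * K * V with hL
  have hLL : L * Lᴴ = Uᴴ * (K * K) * U := by
    simp only [hL, conjTranspose_mul, conjTranspose_conjTranspose, hKh]
    calc Uᴴ * K * V * (Vᴴ * (K * U)) = Uᴴ * K * (V * Vᴴ) * (K * U) := by noncomm_ring
      _ = _ := by rw [hV1]; noncomm_ring
  have hlin : ∑ x, k x * P x = ∑ i, ∑ j, r i * (L i j * star ((Uᴴ * V) i j)).re := by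
    rw [← re_trace_diagonal_mul]
    have h1 : L * (Uᴴ * V)ᴴ = Uᴴ * K * U := by
      simp only [hL, conjTranspose_mul, conjTranspose_conjTranspose]
      calc Uᴴ * K * V * (Vᴴ * U) = Uᴴ * K * (V * Vᴴ) * U := by noncomm_ring
        _ = _ := by rw [hV1]; noncomm_ring
    have h2 : (diagonal (fun i => (r i : ℂ)) * (Uᴴ * K * U)).trace = (K * ρ).trace := by
      rw [hρ, trace_mul_comm, Matrix.mul_assoc, Matrix.mul_assoc, trace_mul_comm]
      simp only [Matrix.mul_assoc]
    rw [h1, h2, hK, Finset.sum_mul, trace_sum, Complex.re_sum]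
    refine Finset.sum_congr rfl fun x _ => ?_
    rw [smul_mul_assoc, trace_smul, smul_eq_mul, Complex.re_ofReal_mul, hP]
  have hquadρ : ((K * K * ρ).trace).re = ∑ i, ∑ j, r i * Complex.normSq (L i j) := by
    have h2 : (diagonal (fun i => (r i : ℂ)) * (L * Lᴴ)).trace = (K * K * ρ).trace := by
      rw [hLL, hρ, trace_mul_comm, Matrix.mul_assoc, Matrix.mul_assoc, trace_mul_comm]
      simp only [Matrix.mul_assoc]
    rw [← h2, re_trace_diagonal_mul]
    simp [Complex.mul_conj]
  have hquadτ : ((K * K * τ).trace).re = ∑ i, ∑ j, t j * Complex.normSq (L i j) := by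
    have h2 : (diagonal (fun i => (t i : ℂ)) * (Lᴴ * Lᴴᴴ)).trace = (K * K * τ).trace := by
      have : Lᴴ * Lᴴᴴ = Vᴴ * (K * K) * V := by
        simp only [hL, conjTranspose_mul, conjTranspose_conjTranspose, hKh]
        calc Vᴴ * (K * U) * (Uᴴ * K * V) = Vᴴ * K * (U * Uᴴ) * (K * V) := by noncomm_ring
          _ = _ := by rw [hU1]; noncomm_ring
      rw [this, hτ, trace_mul_comm, Matrix.mul_assoc, Matrix.mul_assoc, trace_mul_comm]
      simp only [Matrix.mul_assoc]
    rw [← h2, re_trace_diagonal_mul, Finset.sum_comm]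
    simp [mul_comm, Complex.mul_conj]
  have hjρ := hjensen ρ hρp
  have hjτ := hjensen τ hτp
  simp only [← hP, ← hQ] at hjρ hjτ
  calc ∑ x, P x ^ 2 / (Q x + s * P x)
      = 2 * ∑ x, k x * P x - (∑ x, k x ^ 2 * Q x + s * ∑ x, k x ^ 2 * P x) := by
        rw [Finset.mul_sum, Finset.mul_sum, ← Finset.sum_add_distrib, ← Finset.sum_sub_distrib]
        refine Finset.sum_congr rfl fun x _ => ?_
        rw [hterm]; ring
    _ ≤ 2 * ∑ x, k x * P x - (((K * K * τ).trace).re + s * ((K * K * ρ).trace).re) := by gcongr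
    _ = ∑ i, ∑ j, (2 * (r i * (L i j * star ((Uᴴ * V) i j)).re)
          - (t j + s * r i) * Complex.normSq (L i j)) := by
        rw [hlin, hquadρ, hquadτ]
        simp only [Finset.sum_sub_distrib, Finset.mul_sum, add_mul, Finset.sum_add_distrib,
          mul_assoc]
    _ ≤ _ := by
        refine Finset.sum_le_sum fun i _ => Finset.sum_le_sum fun j _ => ?_
        have hri := hr i
        have htj := ht j
        refine two_mul_sub_le_sq_div _ _ (by positivity) (fun h => ?_) _ _
        have : 0 ≤ s * r i := by positivity
        have h3 : s * r i = 0 := by linarith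
        exact (mul_eq_zero.1 h3).resolve_left hs.ne'

/-- Monotonicity of relative entropy under a measurement, with the relative entropy written out in
eigenbases of the two operators. -/
theorem sum_overlap_mul_log_le {n ι : Type*} [Fintype n] [DecidableEq n] [Fintype ι]
    (U V : unitaryGroup n ℂ) {r t : n → ℝ} (hr : ∀ i, 0 ≤ r i) (ht : ∀ i, 0 ≤ t i)
    {ρ τ : Matrix n n ℂ}
    (hρ : ρ = (U : Matrix n n ℂ) * diagonal (fun i => (r i : ℂ)) * (U : Matrix n n ℂ)ᴴ)
    (hτ : τ = (V : Matrix n n ℂ) * diagonal (fun i => (t i : ℂ)) * (V : Matrix n n ℂ)ᴴ)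
    {E : ι → Matrix n n ℂ} (hE : ∀ x, (E x).PosSemidef) (hE1 : ∑ x, E x = 1)
    {P Q : ι → ℝ} (hP : ∀ x, P x = ((E x * ρ).trace).re) (hQ : ∀ x, Q x = ((E x * τ).trace).re)
    (hP0 : ∀ x, 0 ≤ P x) (hQ0 : ∀ x, 0 ≤ Q x) (hPQ : ∀ x, P x ≠ 0 → Q x ≠ 0)
    {w : n → n → ℝ}
    (hw : ∀ i j, w i j =
      Complex.normSq (((U : Matrix n n ℂ)ᴴ * (V : Matrix n n ℂ)) i j))
    (hw1 : ∀ i, ∑ j, w i j = 1) (hwt : ∀ i j, r i * w i j ≠ 0 → t j ≠ 0) :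
    ∑ i, ∑ j, r i * w i j * Real.log (t j / r i) ≤ ∑ x, P x * Real.log (Q x / P x) := by
  have hdiv : ∀ {p q s : ℝ} (v : ℝ), 0 ≤ p → 0 ≤ q → 0 < s →
      p * v / (q / p + s) = p ^ 2 * v / (q + s * p) := by
    intro p q s v hp hq hs
    rcases hp.eq_or_lt with h | h
    · simp [← h]
    · have : q / p + s ≠ 0 := by positivity
      have : q + s * p ≠ 0 := by positivity
      field_simp
  rw [← Fintype.sum_prod_type' (f := fun i j => r i * w i j * Real.log (t j / r i))]
  refine sum_mul_log_le_of_resolvent_le (c := fun a : n × n => r a.1 * w a.1 a.2)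
    (l := fun a => t a.2 / r a.1) (m := fun x => Q x / P x)
    (fun a => div_nonneg (ht _) (hr _)) (fun x => div_nonneg (hQ0 x) (hP0 x))
    (fun a ha => div_ne_zero (hwt _ _ ha) (left_ne_zero_of_mul ha))
    (fun x hx => div_ne_zero (hPQ x hx) hx) ?_ fun s hs => ?_
  · rw [Fintype.sum_prod_type]
    simp only [← Finset.mul_sum, hw1, mul_one, hP]
    rw [← Complex.re_sum, ← trace_sum, ← Finset.sum_mul, hE1, one_mul, hρ, trace_mul_comm,
      ← Matrix.mul_assoc]
    have : (U : Matrix n n ℂ)ᴴ * (U : Matrix n n ℂ) = 1 := mem_unitaryGroup_iff'.1 U.2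
    rw [this, one_mul, trace_diagonal, Complex.re_sum]
    simp
  · have h := measured_resolvent_le U V hr ht hρ hτ hE hE1 hP hQ hs
    rw [Fintype.sum_prod_type]
    convert h using 2 with x _ i _
    · simpa using hdiv 1 (hP0 x) (hQ0 x) hs
    · refine Finset.sum_congr rfl fun j _ => ?_
      rw [hdiv _ (hr i) (ht j) hs, hw]

theorem ptrA_one_kronecker_mul {dA dB : Type} [Fintype dA] [Fintype dB] [DecidableEq dA]
    (X : Matrix dB dB ℂ) (ρ : Matrix (dA × dB) (dA × dB) ℂ) :
    ptrA ((1 : Matrix dA dA ℂ) ⊗ₖ X * ρ) = X * ptrA ρ := by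
  ext b b'
  simp only [ptrA, Matrix.mul_apply, Fintype.sum_prod_type, kroneckerMap_apply, one_apply,
    ite_mul, one_mul, zero_mul, Finset.mul_sum]
  rw [Finset.sum_comm]
  simp [Finset.sum_comm (s := (Finset.univ : Finset dB))]

theorem ptrA_mul_one_kronecker {dA dB : Type} [Fintype dA] [Fintype dB] [DecidableEq dA]
    (Y : Matrix dB dB ℂ) (ρ : Matrix (dA × dB) (dA × dB) ℂ) :
    ptrA (ρ * (1 : Matrix dA dA ℂ) ⊗ₖ Y) = ptrA ρ * Y := by
  ext b b'
  simp only [ptrA, Matrix.mul_apply, Fintype.sum_prod_type, kroneckerMap_apply, one_apply,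
    ite_mul, one_mul, zero_mul, Finset.sum_mul, mul_ite, mul_zero]
  rw [Finset.sum_comm]
  simp [Finset.sum_comm (s := (Finset.univ : Finset dB))]

theorem trace_ptrA {dA dB : Type} [Fintype dA] [Fintype dB]
    (ρ : Matrix (dA × dB) (dA × dB) ℂ) : (ptrA ρ).trace = ρ.trace := by
  simp only [Matrix.trace, ptrA, diag_apply, Fintype.sum_prod_type]
  exact Finset.sum_comm

theorem trace_ptrB {dA dB : Type} [Fintype dA] [Fintype dB]
    (ρ : Matrix (dA × dB) (dA × dB) ℂ) : (ptrB ρ).trace = ρ.trace := by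
  simp only [Matrix.trace, ptrB, diag_apply, Fintype.sum_prod_type]

theorem ptrB_kronecker_one_mul {dA dB : Type} [Fintype dA] [Fintype dB] [DecidableEq dB]
    (X : Matrix dA dA ℂ) (ρ : Matrix (dA × dB) (dA × dB) ℂ) :
    ptrB (X ⊗ₖ (1 : Matrix dB dB ℂ) * ρ) = X * ptrB ρ := by
  ext a a'
  simp only [ptrB, Matrix.mul_apply, Fintype.sum_prod_type, kroneckerMap_apply, one_apply,
    ite_mul, mul_one, zero_mul, mul_ite, mul_zero, Finset.mul_sum, Finset.sum_ite_eq,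
    Finset.mem_univ, if_true]
  exact Finset.sum_comm

theorem trace_kronecker_mul {dA dB : Type} [Fintype dA] [Fintype dB] [DecidableEq dA]
    [DecidableEq dB] (X : Matrix dA dA ℂ) (M : Matrix dB dB ℂ)
    (ρ : Matrix (dA × dB) (dA × dB) ℂ) :
    (X ⊗ₖ M * ρ).trace = (X * ptrB ((1 : Matrix dA dA ℂ) ⊗ₖ M * ρ)).trace := by
  rw [← ptrB_kronecker_one_mul, trace_ptrB, ← Matrix.mul_assoc, ← mul_kronecker_mul, mul_one,
    one_mul]

theorem ptrA_posSemidef {dA dB : Type} [Fintype dA] [Fintype dB]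
    {ρ : Matrix (dA × dB) (dA × dB) ℂ} (hρ : ρ.PosSemidef) : (ptrA ρ).PosSemidef := by
  have : ptrA ρ = ∑ a, ρ.submatrix (fun b => (a, b)) (fun b => (a, b)) := by
    ext b b'
    simp [ptrA, Matrix.sum_apply]
  rw [this]
  exact posSemidef_sum _ fun a _ => hρ.submatrix _

theorem ptrB_one_kronecker_mul_isHermitian {dA dB : Type} [Fintype dA] [Fintype dB]
    [DecidableEq dA] {ρ : Matrix (dA × dB) (dA × dB) ℂ} (hρ : ρ.IsHermitian)
    {M : Matrix dB dB ℂ} (hM : M.IsHermitian) :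
    (ptrB ((1 : Matrix dA dA ℂ) ⊗ₖ M * ρ)).IsHermitian := by
  have hentry : ∀ a a', ptrB ((1 : Matrix dA dA ℂ) ⊗ₖ M * ρ) a a'
      = ∑ b, ∑ b', M b b' * ρ (a, b') (a', b) := fun a a' => by
    simp only [ptrB, Matrix.mul_apply, Fintype.sum_prod_type, kroneckerMap_apply, one_apply,
      ite_mul, one_mul, zero_mul]
    refine Finset.sum_congr rfl fun b _ => ?_
    rw [Finset.sum_comm]
    simp
  ext a a'
  simp only [conjTranspose_apply, hentry, star_sum, star_mul', hM.apply, hρ.apply]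
  exact Finset.sum_comm

theorem Matrix.IsHermitian.eq_unitary_diagonal {n : Type*} [Fintype n] [DecidableEq n]
    {A : Matrix n n ℂ} (hA : A.IsHermitian) :
    A = (hA.eigenvectorUnitary : Matrix n n ℂ) * diagonal (fun i => (hA.eigenvalues i : ℂ)) *
      (hA.eigenvectorUnitary : Matrix n n ℂ)ᴴ :=
  hA.spectral_theorem

/-- Projection onto the `l`-th column of a unitary. -/
def colProj {n : Type*} [Fintype n] [DecidableEq n] (U : unitaryGroup n ℂ) (l : n) :
    Matrix n n ℂ :=
  (U : Matrix n n ℂ) * diagonal (Pi.single l 1) * (U : Matrix n n ℂ)ᴴ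

theorem colProj_posSemidef {n : Type*} [Fintype n] [DecidableEq n] (U : unitaryGroup n ℂ) (l : n) :
    (colProj U l).PosSemidef :=
  (PosSemidef.diagonal (Pi.single_nonneg.2 zero_le_one)).mul_mul_conjTranspose_same _

theorem sum_colProj {n : Type*} [Fintype n] [DecidableEq n] (U : unitaryGroup n ℂ) :
    ∑ l, colProj U l = 1 := by
  have h : ∑ l : n, diagonal (Pi.single l (1 : ℂ)) = (1 : Matrix n n ℂ) := by
    ext i j
    by_cases hij : i = j
    · subst hij
      simp [Matrix.sum_apply, Pi.single_apply]
    · simp [Matrix.sum_apply, hij]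
  simp only [colProj, ← Finset.sum_mul, ← Finset.mul_sum, h, mul_one]
  exact mem_unitaryGroup_iff.1 U.2

theorem trace_colProj {n : Type*} [Fintype n] [DecidableEq n] (U : unitaryGroup n ℂ) (l : n) :
    (colProj U l).trace = 1 := by
  have hU : (U : Matrix n n ℂ)ᴴ * (U : Matrix n n ℂ) = 1 := mem_unitaryGroup_iff'.1 U.2
  rw [colProj, trace_mul_comm, ← Matrix.mul_assoc, hU, one_mul, trace_diagonal]
  simp

theorem trace_colProj_mul {n : Type*} [Fintype n] [DecidableEq n]
    {A : Matrix n n ℂ} (hA : A.IsHermitian) (l : n) :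
    (colProj hA.eigenvectorUnitary l * A).trace = hA.eigenvalues l := by
  have hU : (hA.eigenvectorUnitary : Matrix n n ℂ)ᴴ * (hA.eigenvectorUnitary : Matrix n n ℂ) = 1 :=
    mem_unitaryGroup_iff'.1 hA.eigenvectorUnitary.2
  have hd := hA.eq_unitary_diagonal
  rw [colProj]
  generalize (hA.eigenvectorUnitary : Matrix n n ℂ) = U at hU hd ⊢
  generalize hA.eigenvalues = r at hd ⊢
  rw [hd]
  have : U * diagonal (Pi.single l 1) * Uᴴ * (U * diagonal (fun i => (r i : ℂ)) * Uᴴ)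
      = U * (diagonal (Pi.single l 1) * (Uᴴ * U) * diagonal (fun i => (r i : ℂ))) * Uᴴ := by
    noncomm_ring
  rw [this, hU, mul_one, diagonal_mul_diagonal, trace_mul_comm, ← Matrix.mul_assoc, hU, one_mul,
    trace_diagonal]
  simp [Pi.single_apply]

theorem sum_normSq_row {n : Type*} [Fintype n] [DecidableEq n] (W : unitaryGroup n ℂ) (i : n) :
    ∑ j, Complex.normSq ((W : Matrix n n ℂ) i j) = 1 := by
  have h : ((W : Matrix n n ℂ) * (W : Matrix n n ℂ)ᴴ) i i = 1 := by
    rw [show (W : Matrix n n ℂ) * (W : Matrix n n ℂ)ᴴ = 1 from mem_unitaryGroup_iff.1 W.2,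
      one_apply_eq]
  simp only [Matrix.mul_apply, conjTranspose_apply, RCLike.star_def, Complex.mul_conj] at h
  exact_mod_cast h

/-- The unitary `1 ⊗ V`. -/
def oneKroneckerUnitary (dA : Type) {dB : Type} [Fintype dA] [Fintype dB] [DecidableEq dA]
    [DecidableEq dB] (V : unitaryGroup dB ℂ) : unitaryGroup (dA × dB) ℂ :=
  ⟨(1 : Matrix dA dA ℂ) ⊗ₖ (V : Matrix dB dB ℂ), by
    rw [mem_unitaryGroup_iff, star_eq_conjTranspose, conjTranspose_kronecker, ← mul_kronecker_mul,
      conjTranspose_one, mul_one,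
      show (V : Matrix dB dB ℂ) * (V : Matrix dB dB ℂ)ᴴ = 1 from mem_unitaryGroup_iff.1 V.2,
      one_kronecker_one]⟩

theorem measuredCondEntropies_nonempty {dA dB : Type} [Fintype dA] [Fintype dB] [DecidableEq dA]
    [DecidableEq dB] (ρ : Matrix (dA × dB) (dA × dB) ℂ) :
    (measuredCondEntropies ρ).Nonempty := by
  refine ⟨_, Fintype.card dB, fun i => colProj 1 ((Fintype.equivFin dB).symm i),
    fun i => colProj_posSemidef _ _, fun i => ?_, ?_, rfl⟩
  · have h : ∀ b : dB, diagonal (Pi.single b (1 : ℂ))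
        = vecMulVec (Pi.single b 1) (Pi.single b 1) := fun b => by
      ext x y
      by_cases hxy : x = y
      · subst hxy
        by_cases hb : x = b <;> simp [vecMulVec_apply, hb]
      · by_cases hb : x = b
        · subst hb
          simp [vecMulVec_apply, hxy, Ne.symm hxy]
        · simp [vecMulVec_apply, hxy, Pi.single_apply, hb]
    simp only [colProj, OneMemClass.coe_one, conjTranspose_one, one_mul, mul_one, h]
    exact rank_vecMulVec_le _ _
  · rw [Equiv.sum_comp (Fintype.equivFin dB).symm (fun b => colProj (1 : unitaryGroup dB ℂ) b)]
    exact sum_colProj 1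

/-- The eigenvector overlaps of `ρ` and `1 ⊗ ρ_B`, weighted by the spectrum of `ρ`, have the
spectrum of `ρ_B` as a marginal. -/
theorem sum_overlap_eq_eigenvalue {dA dB : Type} [Fintype dA] [Fintype dB] [DecidableEq dA]
    [DecidableEq dB] {ρ : Matrix (dA × dB) (dA × dB) ℂ} (h : ρ.IsHermitian)
    (hB : (ptrA ρ).IsHermitian) (b : dB) :
    ∑ a, ∑ i, h.eigenvalues i *
      Complex.normSq (((h.eigenvectorUnitary : Matrix (dA × dB) (dA × dB) ℂ)ᴴ *
        (oneKroneckerUnitary dA hB.eigenvectorUnitary : Matrix (dA × dB) (dA × dB) ℂ)) i (a, b))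
      = hB.eigenvalues b := by
  have hVB : (hB.eigenvectorUnitary : Matrix dB dB ℂ)ᴴ * (hB.eigenvectorUnitary : Matrix dB dB ℂ)
      = 1 := mem_unitaryGroup_iff'.1 hB.eigenvectorUnitary.2
  have hρ := h.eq_unitary_diagonal
  have hρB := hB.eq_unitary_diagonal
  simp only [oneKroneckerUnitary]
  generalize (h.eigenvectorUnitary : Matrix (dA × dB) (dA × dB) ℂ) = U at *
  generalize (hB.eigenvectorUnitary : Matrix dB dB ℂ) = VB at *
  generalize h.eigenvalues = r at *
  generalize hB.eigenvalues = t at *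
  set W := Uᴴ * (1 : Matrix dA dA ℂ) ⊗ₖ VB with hW
  have h1 : ptrA (Wᴴ * diagonal (fun i => (r i : ℂ)) * W) = diagonal (fun i => (t i : ℂ)) := by
    have : Wᴴ * diagonal (fun i => (r i : ℂ)) * W
        = (1 : Matrix dA dA ℂ) ⊗ₖ VBᴴ * (ρ * (1 : Matrix dA dA ℂ) ⊗ₖ VB) := by
      rw [hρ, hW, conjTranspose_mul, conjTranspose_kronecker, conjTranspose_one,
        conjTranspose_conjTranspose]
      simp only [Matrix.mul_assoc]
    rw [this, ptrA_one_kronecker_mul, ptrA_mul_one_kronecker, hρB]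
    calc VBᴴ * (VB * diagonal (fun i => (t i : ℂ)) * VBᴴ * VB)
        = (VBᴴ * VB) * diagonal (fun i => (t i : ℂ)) * (VBᴴ * VB) := by noncomm_ring
      _ = _ := by rw [hVB, one_mul, mul_one]
  have h2 := congrFun (congrFun h1 b) b
  rw [diagonal_apply_eq] at h2
  simp only [ptrA, Matrix.mul_apply (N := W), mul_diagonal, conjTranspose_apply] at h2
  have h3 := congrArg Complex.re h2
  rw [Complex.ofReal_re] at h3
  rw [← h3, Complex.re_sum]
  refine Finset.sum_congr rfl fun a _ => ?_
  rw [Complex.re_sum]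
  refine Finset.sum_congr rfl fun i _ => ?_
  rw [mul_comm (star _), mul_assoc, Complex.re_ofReal_mul, mul_comm (star _), RCLike.star_def,
    Complex.mul_conj, Complex.ofReal_re]

theorem pOf_nonneg {dA dB : Type} [Fintype dA] [Fintype dB] [DecidableEq dA] [DecidableEq dB]
    {ρ : Matrix (dA × dB) (dA × dB) ℂ} (hρ : ρ.PosSemidef) {M : Matrix dB dB ℂ}
    (hM : M.PosSemidef) : 0 ≤ pOf ρ M :=
  (Complex.nonneg_iff.1 ((PosSemidef.one.kronecker hM).trace_mul_nonneg hρ)).1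

theorem condState_isHermitian {dA dB : Type} [Fintype dA] [Fintype dB] [DecidableEq dA]
    [DecidableEq dB] {ρ : Matrix (dA × dB) (dA × dB) ℂ} (hρ : ρ.IsHermitian) {M : Matrix dB dB ℂ}
    (hM : M.IsHermitian) : (condState ρ M).IsHermitian := by
  have h := ptrB_one_kronecker_mul_isHermitian hρ hM
  rw [Matrix.IsHermitian, condState, conjTranspose_smul, h.eq, star_inv₀, RCLike.star_def,
    Complex.conj_ofReal]

/-- Measuring `M` on `B` and then an eigenprojection of the conditional state on `A` has
probability equal to the outcome probability times the eigenvalue. -/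
theorem re_trace_colProj_kronecker_mul {dA dB : Type} [Fintype dA] [Fintype dB] [DecidableEq dA]
    [DecidableEq dB] {ρ : Matrix (dA × dB) (dA × dB) ℂ} (hρ : ρ.PosSemidef) {M : Matrix dB dB ℂ}
    (hM : M.PosSemidef) (hκ : (condState ρ M).IsHermitian) (l : dA) :
    ((colProj hκ.eigenvectorUnitary l ⊗ₖ M * ρ).trace).re = pOf ρ M * hκ.eigenvalues l := by
  by_cases hp : pOf ρ M = 0
  · rw [hp, zero_mul]
    have hnn : ∀ l, 0 ≤ ((colProj hκ.eigenvectorUnitary l ⊗ₖ M * ρ).trace).re := fun l =>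
      (Complex.nonneg_iff.1
        (((colProj_posSemidef _ l).kronecker hM).trace_mul_nonneg hρ)).1
    have hsum : ∑ l, ((colProj hκ.eigenvectorUnitary l ⊗ₖ M * ρ).trace).re = 0 := by
      rw [← hp, pOf, trace_kronecker_mul, ← sum_colProj hκ.eigenvectorUnitary, Finset.sum_mul,
        trace_sum, Complex.re_sum, sum_colProj]
      simp only [trace_kronecker_mul (colProj _ _)]
    exact (Finset.sum_eq_zero_iff_of_nonneg fun l _ => hnn l).1 hsum l (Finset.mem_univ l)
  · have h : ptrB ((1 : Matrix dA dA ℂ) ⊗ₖ M * ρ) = (pOf ρ M : ℂ) • condState ρ M := by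
      rw [condState, smul_smul, mul_inv_cancel₀ (by exact_mod_cast hp), one_smul]
    rw [trace_kronecker_mul, h, mul_smul_comm, trace_smul, trace_colProj_mul, smul_eq_mul,
      ← Complex.ofReal_mul, Complex.ofReal_re]

theorem vNEntropy_sub_le_of_povm {dA dB : Type} [Fintype dA] [Fintype dB] [DecidableEq dA]
    [DecidableEq dB] {ρ : Matrix (dA × dB) (dA × dB) ℂ} (hρ : ρ.PosSemidef) {m : ℕ}
    {M : Fin m → Matrix dB dB ℂ} (hM : ∀ k, (M k).PosSemidef) (hM1 : ∑ k, M k = 1) :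
    vNEntropy ρ - vNEntropy (ptrA ρ) ≤ ∑ k, pOf ρ (M k) * vNEntropy (condState ρ (M k)) := by
  have hBp := ptrA_posSemidef hρ
  have h := hρ.1
  have hB := hBp.1
  have hκ : ∀ k, (condState ρ (M k)).IsHermitian := fun k => condState_isHermitian h (hM k).1
  set U := h.eigenvectorUnitary
  set V := oneKroneckerUnitary dA hB.eigenvectorUnitary with hV
  set w : dA × dB → dA × dB → ℝ := fun i j =>
    Complex.normSq (((U : Matrix (dA × dB) (dA × dB) ℂ)ᴴ *
      (V : Matrix (dA × dB) (dA × dB) ℂ)) i j) with hw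
  set E : Fin m × dA → Matrix (dA × dB) (dA × dB) ℂ := fun x =>
    colProj (hκ x.1).eigenvectorUnitary x.2 ⊗ₖ M x.1 with hE
  have hr : ∀ i, 0 ≤ h.eigenvalues i := hρ.eigenvalues_nonneg
  have ht : ∀ b, 0 ≤ hB.eigenvalues b := hBp.eigenvalues_nonneg
  have hw0 : ∀ i j, 0 ≤ w i j := fun i j => Complex.normSq_nonneg _
  have hw1 : ∀ i, ∑ j, w i j = 1 := sum_normSq_row (star U * V)
  have hmarg : ∀ b, ∑ a, ∑ i, h.eigenvalues i * w i (a, b) = hB.eigenvalues b :=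
    sum_overlap_eq_eigenvalue h hB
  have hwt : ∀ i (j : dA × dB), h.eigenvalues i * w i j ≠ 0 → hB.eigenvalues j.2 ≠ 0 := by
    rintro i ⟨a, b⟩ hne h0
    rw [← hmarg b] at h0
    have hnn : ∀ i j, 0 ≤ h.eigenvalues i * w i j := fun i j => mul_nonneg (hr i) (hw0 i j)
    have h1 := (Finset.sum_eq_zero_iff_of_nonneg fun a _ =>
      Finset.sum_nonneg fun i _ => hnn i (a, b)).1 h0 a (Finset.mem_univ a)
    exact hne ((Finset.sum_eq_zero_iff_of_nonneg fun i _ => hnn i (a, b)).1 h1 i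
      (Finset.mem_univ i))
  have hτ : (1 : Matrix dA dA ℂ) ⊗ₖ ptrA ρ = (V : Matrix (dA × dB) (dA × dB) ℂ) *
      diagonal (fun j : dA × dB => (hB.eigenvalues j.2 : ℂ)) * (V : Matrix (dA × dB) (dA × dB) ℂ)ᴴ := by
    have hd : diagonal (fun j : dA × dB => (hB.eigenvalues j.2 : ℂ))
        = (1 : Matrix dA dA ℂ) ⊗ₖ diagonal (fun b => (hB.eigenvalues b : ℂ)) := by
      rw [← diagonal_one, diagonal_kronecker_diagonal]
      simp
    rw [hd, hV]
    simp only [oneKroneckerUnitary, conjTranspose_kronecker, ← mul_kronecker_mul,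
      conjTranspose_one, mul_one, ← hB.eq_unitary_diagonal]
  have hE1 : ∑ x, E x = 1 := by
    rw [Fintype.sum_prod_type]
    have : ∀ k, ∑ l, E (k, l) = (1 : Matrix dA dA ℂ) ⊗ₖ M k := fun k => by
      rw [← sum_colProj (hκ k).eigenvectorUnitary]
      ext i j
      simp [hE, Matrix.sum_apply, Finset.sum_mul]
    simp only [this]
    rw [← one_kronecker_one, ← hM1]
    ext i j
    simp [Matrix.sum_apply, Finset.mul_sum]
  have hP : ∀ x : Fin m × dA, pOf ρ (M x.1) * (hκ x.1).eigenvalues x.2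
      = ((E x * ρ).trace).re := fun x =>
    (re_trace_colProj_kronecker_mul hρ (hM x.1) (hκ x.1) x.2).symm
  have hQ : ∀ x : Fin m × dA, pOf ρ (M x.1)
      = ((E x * (1 : Matrix dA dA ℂ) ⊗ₖ ptrA ρ).trace).re := fun x => by
    rw [hE, ← mul_kronecker_mul, trace_kronecker, mul_one, trace_colProj, one_mul,
      ← ptrA_one_kronecker_mul, trace_ptrA, pOf]
  have hEp : ∀ x, (E x).PosSemidef := fun x => (colProj_posSemidef _ _).kronecker (hM x.1)
  have key := sum_overlap_mul_log_le U V hr (fun j : dA × dB => ht j.2) h.eq_unitary_diagonal hτ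
    hEp hE1 hP hQ
    (fun x => by
      rw [hP]; exact (Complex.nonneg_iff.1 ((hEp x).trace_mul_nonneg hρ)).1)
    (fun x => pOf_nonneg hρ (hM x.1)) (fun x => left_ne_zero_of_mul) (w := w)
    (fun i j => rfl) hw1 hwt
  have hleft : ∑ i, ∑ j : dA × dB, h.eigenvalues i * w i j *
      Real.log (hB.eigenvalues j.2 / h.eigenvalues i) = vNEntropy ρ - vNEntropy (ptrA ρ) := by
    have hsplit : ∀ i (j : dA × dB), h.eigenvalues i * w i j *
        Real.log (hB.eigenvalues j.2 / h.eigenvalues i)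
        = h.eigenvalues i * w i j * Real.log (hB.eigenvalues j.2)
          + w i j * Real.negMulLog (h.eigenvalues i) := by
      intro i j
      by_cases hc : h.eigenvalues i * w i j = 0
      · rcases mul_eq_zero.1 hc with h0 | h0 <;> simp [h0]
      · rw [Real.log_div (hwt i j hc) (left_ne_zero_of_mul hc), Real.negMulLog]
        ring
    have hfirst : ∑ i, ∑ j : dA × dB, h.eigenvalues i * w i j * Real.log (hB.eigenvalues j.2)
        = -vNEntropy (ptrA ρ) := by
      rw [Finset.sum_comm, Fintype.sum_prod_type, Finset.sum_comm, vNEntropy, dif_pos hB,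
        ← Finset.sum_neg_distrib]
      refine Finset.sum_congr rfl fun b _ => ?_
      simp only [← Finset.sum_mul, hmarg, Real.negMulLog]
      ring
    have hsecond : ∑ i, ∑ j, w i j * Real.negMulLog (h.eigenvalues i) = vNEntropy ρ := by
      simp only [← Finset.sum_mul, hw1, one_mul, vNEntropy, dif_pos h]
    simp only [hsplit, Finset.sum_add_distrib, hfirst, hsecond]
    ring
  have hright : ∀ k, ∑ l, pOf ρ (M k) * (hκ k).eigenvalues l *
      Real.log (pOf ρ (M k) / (pOf ρ (M k) * (hκ k).eigenvalues l))
      = pOf ρ (M k) * vNEntropy (condState ρ (M k)) := by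
    intro k
    rw [vNEntropy, dif_pos (hκ k), Finset.mul_sum]
    refine Finset.sum_congr rfl fun l _ => ?_
    by_cases hp : pOf ρ (M k) = 0
    · simp [hp]
    · rw [div_mul_cancel_left₀ hp, Real.log_inv, Real.negMulLog]
      ring
  rw [hleft, Fintype.sum_prod_type] at key
  simpa only [hright] using key

theorem discord_nonneg {dA dB : Type} [Fintype dA] [DecidableEq dA] [Fintype dB] [DecidableEq dB]
    (ρ : Matrix (dA × dB) (dA × dB) ℂ) (hρ : IsDensity ρ) :
    0 ≤ discord ρ := by
  have h : vNEntropy ρ - vNEntropy (ptrA ρ) ≤ sInf (measuredCondEntropies ρ) := by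
    refine le_csInf (measuredCondEntropies_nonempty ρ) ?_
    rintro _ ⟨m, M, hM, -, hM1, rfl⟩
    exact vNEntropy_sub_le_of_povm hρ.1 hM hM1
  rw [discord]
  linarith

end
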